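/- arXiv:2510.24387 — 3 statements merged into one kernel-verified Lean document; each statement's English description precedes it below -/
import Mathlib

section
/- Let n ≥ 2 and let P_n be the path on vertices v_0, v_1, …, v_{n−1}. If n is odd, then min_{0 ≤ k ≤ n−1} J(v_k) = (n³ − 3n² + 2n)/3, and this minimum is achieved exactly at k = (n−1)/2. If n is even, then min_{0 ≤ k ≤ n−1} J(v_k) = (n³ − 3n² + 5n)/3 − 1, and this minimum is achieved exactly at k = (n−2)/2 and k = n/2. -/
open Finset
open scoped Classical

/-- The degree of vertex `v` in `G`. -/
noncomputable def gdeg {V : Type*} [Fintype V] (G : SimpleGraph V) (v : V) : ℕ :=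
  (Finset.univ.filter fun u => G.Adj v u).card

/-- `ℓ(u,v;w) = (d(u,w) + d(v,w) - d(u,v))/2`. -/
noncomputable def ell {V : Type*} (G : SimpleGraph V) (u v w : V) : ℚ :=
  ((G.dist u w : ℚ) + (G.dist v w : ℚ) - (G.dist u v : ℚ)) / 2

/-- The hitting time `H(u,w) = Σ_v ℓ(u,v;w)·deg(v)` (valid formula on trees). -/
noncomputable def hitTime {V : Type*} [Fintype V] (G : SimpleGraph V) (u w : V) : ℚ :=
  ∑ v, ell G u v w * (gdeg G v : ℚ)

/-- The joining time to `w`: `J(w) = Σ_u deg(u)·H(u,w)`. -/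
noncomputable def joinTime {V : Type*} [Fintype V] (G : SimpleGraph V) (w : V) : ℚ :=
  ∑ u, (gdeg G u : ℚ) * hitTime G u w

/-- `J_min(G) = min_{w} J(w)` (junk value 0 on the empty graph). -/
noncomputable def Jmin {V : Type*} [Fintype V] (G : SimpleGraph V) : ℚ :=
  if h : Nonempty V then
    haveI := h
    Finset.univ.inf' Finset.univ_nonempty (joinTime G)
  else 0

/-- The best meeting time `T_bestmeet(G) = J_min(G)/(2(n-1))`. -/
noncomputable def bestMeet {V : Type*} [Fintype V] (G : SimpleGraph V) : ℚ :=
  Jmin G / (2 * ((Fintype.card V : ℚ) - 1))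

/-- The diameter of `G` : the maximum of `d(u,v)` over pairs of vertices. -/
noncomputable def gdiam {V : Type*} [Fintype V] (G : SimpleGraph V) : ℕ :=
  Finset.univ.sup fun p : V × V => G.dist p.1 p.2

/-- The lever of order `n` and diameter `d` with fulcrum `v_k`: a path `v_0, …, v_d`
(on vertices `0, …, d`) together with `n - d - 1` pendant leaves (vertices `d+1, …, n-1`)
all adjacent to `v_k`. -/
def leverGraph (n d k : ℕ) : SimpleGraph (Fin n) :=
  SimpleGraph.fromRel fun i j =>
    (i.val + 1 = j.val ∧ j.val ≤ d) ∨ (i.val = k ∧ d < j.val)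

/-- The balanced lever `L_{n,d}`: the lever with fulcrum `v_{⌊d/2⌋}`. -/
def balancedLever (n d : ℕ) : SimpleGraph (Fin n) :=
  leverGraph n d (d / 2)

/-- The double broom of order `n`, diameter `d`, with `a` extra pendant leaves adjacent
to `v_1` and `n - d - 1 - a` extra pendant leaves adjacent to `v_{d-1}`.  The path
`v_0, …, v_d` sits on vertices `0, …, d`, the leaves at `v_1` are `d+1, …, d+a`, and the
leaves at `v_{d-1}` are `d+a+1, …, n-1`. -/
def doubleBroom (n d a : ℕ) : SimpleGraph (Fin n) :=
  SimpleGraph.fromRel fun i j =>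
    (i.val + 1 = j.val ∧ j.val ≤ d) ∨
    (i.val = 1 ∧ d < j.val ∧ j.val ≤ d + a) ∨
    (i.val = d - 1 ∧ d + a < j.val)

/-- The balanced double broom `D_{n,d}`, with `⌊(n-d-1)/2⌋` leaves at `v_1`
and `⌈(n-d-1)/2⌉` leaves at `v_{d-1}`. -/
def balancedDoubleBroom (n d : ℕ) : SimpleGraph (Fin n) :=
  doubleBroom n d ((n - d - 1) / 2)

/-- The broom `B_{n,d}`: a path `v_0, …, v_d` with `n - d - 1` pendant leaves adjacent to `v_1`. -/
def broomGraph (n d : ℕ) : SimpleGraph (Fin n) :=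
  doubleBroom n d (n - d - 1)

/-- The star `S_n = K_{1,n-1}` with center `0`. -/
def starGraph (n : ℕ) : SimpleGraph (Fin n) :=
  SimpleGraph.fromRel fun i _ => i.val = 0

lemma SimpleGraph.Walk.natAbs_sub_le_length_of_pathGraph {n : ℕ} {u v : Fin n}
    (p : (SimpleGraph.pathGraph n).Walk u v) : ((u : ℤ) - v).natAbs ≤ p.length := by
  induction p with
  | nil => simp
  | cons h p ih =>
    rw [SimpleGraph.pathGraph_adj] at h
    rw [SimpleGraph.Walk.length_cons]
    omega

lemma SimpleGraph.dist_pathGraph_le {n : ℕ} (d : ℕ) (u v : Fin n) (h : (u : ℕ) + d = v) :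
    (SimpleGraph.pathGraph n).dist u v ≤ d := by
  suffices ∃ p : (SimpleGraph.pathGraph n).Walk u v, p.length = d by
    obtain ⟨p, hp⟩ := this
    exact hp ▸ SimpleGraph.dist_le p
  induction d generalizing u with
  | zero =>
    obtain rfl : u = v := Fin.ext (by simpa using h)
    exact ⟨SimpleGraph.Walk.nil, rfl⟩
  | succ d ih =>
    have hu : (u : ℕ) + 1 < n := by omega
    obtain ⟨p, hp⟩ := ih ⟨u + 1, hu⟩ (by simp only; omega)
    exact ⟨SimpleGraph.Walk.cons (SimpleGraph.pathGraph_adj.2 (Or.inl rfl)) p, by simp [hp]⟩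

lemma SimpleGraph.dist_pathGraph {n : ℕ} (u v : Fin n) :
    (SimpleGraph.pathGraph n).dist u v = ((u : ℤ) - v).natAbs := by
  apply le_antisymm
  · rcases le_total (u : ℕ) v with h | h
    · exact SimpleGraph.dist_pathGraph_le _ u v (by omega)
    · rw [SimpleGraph.dist_comm]
      exact SimpleGraph.dist_pathGraph_le _ v u (by omega)
  · obtain ⟨p, hp⟩ := (SimpleGraph.pathGraph_preconnected n u v).exists_walk_length_eq_dist
    exact hp ▸ p.natAbs_sub_le_length_of_pathGraph

lemma SimpleGraph.cast_dist_pathGraph {n : ℕ} (u v : Fin n) :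
    ((SimpleGraph.pathGraph n).dist u v : ℚ) = |(u : ℚ) - v| := by
  rw [SimpleGraph.dist_pathGraph, Nat.cast_natAbs]
  push_cast
  rfl

lemma gdeg_pathGraph {N : ℕ} (v : Fin (N + 1)) :
    gdeg (SimpleGraph.pathGraph (N + 1)) v =
      (if (v : ℕ) = 0 then 0 else 1) + (if (v : ℕ) = N then 0 else 1) := by
  have hsplit : ∀ u : Fin (N + 1), (if (SimpleGraph.pathGraph (N + 1)).Adj v u then 1 else 0) =
      (if (v : ℕ) + 1 = u then 1 else 0) + (if (v : ℕ) = (u : ℕ) + 1 then 1 else 0) := by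
    intro u
    rw [SimpleGraph.pathGraph_adj]
    split_ifs <;> omega
  rw [gdeg, Finset.card_filter, Finset.sum_congr rfl fun u _ => hsplit u,
    Fin.sum_univ_eq_sum_range
      (fun i => (if (v : ℕ) + 1 = i then 1 else 0) + (if (v : ℕ) = i + 1 then 1 else 0)),
    Finset.sum_add_distrib, Finset.sum_ite_eq]
  obtain ⟨v, hv⟩ := v
  cases v with
  | zero => simp; split_ifs <;> omega
  | succ v => simp; split_ifs <;> omega

/-- Summing against the degree on a path is summing over both endpoints of every edge. -/
lemma sum_mul_gdeg_pathGraph (N : ℕ) (f : ℕ → ℚ) :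
    ∑ v : Fin (N + 1), f v * (gdeg (SimpleGraph.pathGraph (N + 1)) v : ℚ) =
      ∑ i ∈ range N, (f i + f (i + 1)) := by
  simp only [gdeg_pathGraph, Nat.cast_add, Nat.cast_ite, Nat.cast_zero, Nat.cast_one, mul_add]
  rw [Fin.sum_univ_eq_sum_range
      (fun i => f i * (if i = 0 then 0 else 1) + f i * (if i = N then 0 else 1)),
    Finset.sum_add_distrib, Finset.sum_range_succ', Finset.sum_range_succ, Finset.sum_add_distrib,
    add_comm]
  congr 1
  · simp only [if_true, mul_zero, add_zero]
    refine Finset.sum_congr rfl fun i hi => ?_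
    rw [if_neg (Finset.mem_range.1 hi).ne, mul_one]
  · simp

lemma hitTime_pathGraph_eq_sum {N : ℕ} (u k : Fin (N + 1)) :
    hitTime (SimpleGraph.pathGraph (N + 1)) u k =
      ∑ i ∈ range N, ((|(u : ℚ) - k| + |(i : ℚ) - k| - |(u : ℚ) - i|) / 2 +
        (|(u : ℚ) - k| + |((i + 1 : ℕ) : ℚ) - k| - |(u : ℚ) - (i + 1 : ℕ)|) / 2) := by
  rw [← sum_mul_gdeg_pathGraph N
    fun i => (|(u : ℚ) - k| + |(i : ℚ) - k| - |(u : ℚ) - i|) / 2]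
  simp only [hitTime, ell, SimpleGraph.cast_dist_pathGraph]

lemma sum_range_odd (a : ℕ) : ∑ j ∈ range a, (2 * (j : ℚ) + 1) = (a : ℚ) ^ 2 := by
  induction a with
  | zero => simp
  | succ a ih => rw [Finset.sum_range_succ, ih]; push_cast; ring

lemma hitTime_pathGraph_of_le {N : ℕ} (u k : Fin (N + 1)) (h : (u : ℕ) ≤ k) :
    hitTime (SimpleGraph.pathGraph (N + 1)) u k = (k : ℚ) ^ 2 - (u : ℚ) ^ 2 := by
  rw [hitTime_pathGraph_eq_sum]
  obtain ⟨u, hu⟩ := u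
  obtain ⟨k, hk⟩ := k
  obtain ⟨a, rfl⟩ := Nat.exists_eq_add_of_le (show u ≤ k from h)
  obtain ⟨m, rfl⟩ := Nat.exists_eq_add_of_le (Nat.lt_succ_iff.1 hk)
  rw [Finset.sum_range_add, Finset.sum_range_add]
  have h₁ : ∀ i ∈ range u, (|(u : ℚ) - (u + a : ℕ)| + |(i : ℚ) - (u + a : ℕ)| - |(u : ℚ) - i|) / 2 +
      (|(u : ℚ) - (u + a : ℕ)| + |((i + 1 : ℕ) : ℚ) - (u + a : ℕ)| - |(u : ℚ) - (i + 1 : ℕ)|) / 2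
      = 2 * a := by
    intro i hi
    have hi' : (i : ℚ) + 1 ≤ u := by exact_mod_cast Finset.mem_range.1 hi
    have ha : (0 : ℚ) ≤ a := a.cast_nonneg
    push_cast
    rw [abs_of_nonpos (by linarith), abs_of_nonpos (by linarith), abs_of_nonneg (by linarith),
      abs_of_nonpos (by linarith), abs_of_nonneg (by linarith)]
    ring
  have h₂ : ∀ j ∈ range a, (|(u : ℚ) - (u + a : ℕ)| + |((u + j : ℕ) : ℚ) - (u + a : ℕ)|
        - |(u : ℚ) - (u + j : ℕ)|) / 2 +
      (|(u : ℚ) - (u + a : ℕ)| + |((u + j + 1 : ℕ) : ℚ) - (u + a : ℕ)|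
        - |(u : ℚ) - (u + j + 1 : ℕ)|) / 2 = 2 * a - (2 * j + 1) := by
    intro j hj
    have hj' : (j : ℚ) + 1 ≤ a := by exact_mod_cast Finset.mem_range.1 hj
    have hj₀ : (0 : ℚ) ≤ j := j.cast_nonneg
    push_cast
    rw [abs_of_nonpos (by linarith), abs_of_nonpos (by linarith), abs_of_nonpos (by linarith),
      abs_of_nonpos (by linarith), abs_of_nonpos (by linarith)]
    ring
  have h₃ : ∀ j ∈ range m, (|(u : ℚ) - (u + a : ℕ)| + |((u + a + j : ℕ) : ℚ) - (u + a : ℕ)|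
        - |(u : ℚ) - (u + a + j : ℕ)|) / 2 +
      (|(u : ℚ) - (u + a : ℕ)| + |((u + a + j + 1 : ℕ) : ℚ) - (u + a : ℕ)|
        - |(u : ℚ) - (u + a + j + 1 : ℕ)|) / 2 = 0 := by
    intro j _
    have ha : (0 : ℚ) ≤ a := a.cast_nonneg
    have hj₀ : (0 : ℚ) ≤ j := j.cast_nonneg
    push_cast
    rw [abs_of_nonpos (by linarith), abs_of_nonneg (by linarith), abs_of_nonpos (by linarith),
      abs_of_nonneg (by linarith), abs_of_nonpos (by linarith)]
    ring
  rw [Finset.sum_congr rfl h₁, Finset.sum_congr rfl h₂, Finset.sum_congr rfl h₃,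
    Finset.sum_sub_distrib, sum_range_odd]
  simp only [Finset.sum_const, Finset.card_range, nsmul_eq_mul]
  push_cast
  ring

/-- Reversing the path does not change hitting times. -/
lemma hitTime_pathGraph_rev {N : ℕ} (u k : Fin (N + 1)) :
    hitTime (SimpleGraph.pathGraph (N + 1)) u.rev k.rev =
      hitTime (SimpleGraph.pathGraph (N + 1)) u k := by
  have hdist : ∀ x y : Fin (N + 1), (SimpleGraph.pathGraph (N + 1)).dist x.rev y.rev =
      (SimpleGraph.pathGraph (N + 1)).dist x y := by
    intro x y
    simp only [SimpleGraph.dist_pathGraph, Fin.val_rev]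
    omega
  have hdeg : ∀ x : Fin (N + 1), gdeg (SimpleGraph.pathGraph (N + 1)) x.rev =
      gdeg (SimpleGraph.pathGraph (N + 1)) x := by
    intro x
    simp only [gdeg_pathGraph, Fin.val_rev]
    split_ifs <;> omega
  rw [hitTime, ← Equiv.sum_comp Fin.revPerm]
  simp only [hitTime, ell, Fin.revPerm_apply, hdist, hdeg]

lemma hitTime_pathGraph_of_ge {N : ℕ} (u k : Fin (N + 1)) (h : (k : ℕ) ≤ u) :
    hitTime (SimpleGraph.pathGraph (N + 1)) u k = ((N : ℚ) - k) ^ 2 - ((N : ℚ) - u) ^ 2 := by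
  have hk : (k : ℕ) ≤ N := by omega
  have hu : (u : ℕ) ≤ N := by omega
  rw [← hitTime_pathGraph_rev, hitTime_pathGraph_of_le _ _ (by simp only [Fin.val_rev]; omega)]
  simp only [Fin.val_rev, Nat.add_sub_add_right, Nat.cast_sub hk, Nat.cast_sub hu]

lemma joinTime_pathGraph {k m : ℕ} (hk : k < k + m + 1) :
    joinTime (SimpleGraph.pathGraph (k + m + 1)) ⟨k, hk⟩ =
      (4 * (k : ℚ) ^ 3 - k) / 3 + (4 * (m : ℚ) ^ 3 - m) / 3 := by
  have hH : ∀ u : Fin (k + m + 1), (gdeg (SimpleGraph.pathGraph (k + m + 1)) u : ℚ) *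
      hitTime (SimpleGraph.pathGraph (k + m + 1)) u ⟨k, hk⟩ =
      (if (u : ℕ) ≤ k then (k : ℚ) ^ 2 - (u : ℚ) ^ 2 else (m : ℚ) ^ 2 - ((k : ℚ) + m - u) ^ 2) *
        (gdeg (SimpleGraph.pathGraph (k + m + 1)) u : ℚ) := by
    intro u
    rw [mul_comm]
    split_ifs with h
    · rw [hitTime_pathGraph_of_le _ _ h]
    · rw [hitTime_pathGraph_of_ge _ _ (le_of_not_ge h)]
      push_cast
      ring
  rw [joinTime, Finset.sum_congr rfl fun u _ => hH u, sum_mul_gdeg_pathGraph (k + m)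
    fun i => if i ≤ k then (k : ℚ) ^ 2 - (i : ℚ) ^ 2 else (m : ℚ) ^ 2 - ((k : ℚ) + m - i) ^ 2,
    Finset.sum_range_add]
  congr 1
  · have hsum : ∀ a : ℕ, ∑ i ∈ range a, ((k : ℚ) ^ 2 - (i : ℚ) ^ 2 +
        ((k : ℚ) ^ 2 - ((i + 1 : ℕ) : ℚ) ^ 2)) = 2 * a * (k : ℚ) ^ 2 - (2 * (a : ℚ) ^ 3 + a) / 3 := by
      intro a
      induction a with
      | zero => simp
      | succ a ih => rw [Finset.sum_range_succ, ih]; push_cast; ring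
    rw [Finset.sum_congr rfl fun i hi => by
      rw [if_pos (Finset.mem_range.1 hi).le, if_pos (Nat.succ_le_of_lt (Finset.mem_range.1 hi))],
      hsum]
    ring
  · have hsum : ∀ a : ℕ, ∑ i ∈ range a, ((m : ℚ) ^ 2 - ((m : ℚ) - i) ^ 2 +
        ((m : ℚ) ^ 2 - ((m : ℚ) - (i + 1)) ^ 2)) =
        2 * m * (a : ℚ) ^ 2 - (2 * (a : ℚ) ^ 3 + a) / 3 := by
      intro a
      induction a with
      | zero => simp
      | succ a ih => rw [Finset.sum_range_succ, ih]; push_cast; ring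
    trans (∑ i ∈ range m, ((m : ℚ) ^ 2 - ((m : ℚ) - i) ^ 2 +
        ((m : ℚ) ^ 2 - ((m : ℚ) - (i + 1)) ^ 2)))
    · refine Finset.sum_congr rfl fun i _ => ?_
      rw [if_neg (show ¬ k + i + 1 ≤ k by omega)]
      congr 1
      · split_ifs with h
        · obtain rfl : i = 0 := by omega
          simp
        · push_cast; ring
      · push_cast; ring
    · rw [hsum]
      ring

/-- The joining time exceeds the value at an ideal midpoint by a multiple of the squared offset. -/
lemma joinTime_pathGraph_eq {n : ℕ} (k : Fin n) :
    joinTime (SimpleGraph.pathGraph n) k =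
      ((n : ℚ) ^ 3 - 3 * (n : ℚ) ^ 2 + 2 * n) / 3 + (n - 1) * (2 * k - (n - 1)) ^ 2 := by
  obtain ⟨k, hk⟩ := k
  obtain ⟨m, rfl⟩ := Nat.exists_eq_add_of_lt hk
  rw [joinTime_pathGraph]
  push_cast
  ring

/-- extremal joining times on the path `P_n`. -/
theorem path_min_join_time (n : ℕ) (hn : 2 ≤ n) :
    (Odd n →
      (∀ k : Fin n, ((n : ℚ)^3 - 3*(n : ℚ)^2 + 2*(n : ℚ))/3 ≤
          joinTime (SimpleGraph.pathGraph n) k) ∧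
      (∀ k : Fin n, joinTime (SimpleGraph.pathGraph n) k =
          ((n : ℚ)^3 - 3*(n : ℚ)^2 + 2*(n : ℚ))/3 ↔ (k : ℕ) = (n - 1)/2)) ∧
    (Even n →
      (∀ k : Fin n, ((n : ℚ)^3 - 3*(n : ℚ)^2 + 5*(n : ℚ))/3 - 1 ≤
          joinTime (SimpleGraph.pathGraph n) k) ∧
      (∀ k : Fin n, joinTime (SimpleGraph.pathGraph n) k =
          ((n : ℚ)^3 - 3*(n : ℚ)^2 + 5*(n : ℚ))/3 - 1 ↔
          ((k : ℕ) = (n - 2)/2 ∨ (k : ℕ) = n/2))) := by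
  have hn' : (0 : ℚ) < n - 1 := by
    have : (2 : ℚ) ≤ n := by exact_mod_cast hn
    linarith
  refine ⟨fun hodd => ⟨fun k => ?_, fun k => ?_⟩, fun heven => ?_⟩
  · rw [joinTime_pathGraph_eq]
    have := mul_nonneg hn'.le (sq_nonneg (2 * (k : ℚ) - (n - 1)))
    linarith
  · rw [joinTime_pathGraph_eq, add_eq_left, mul_eq_zero, or_iff_right hn'.ne', sq_eq_zero_iff]
    obtain ⟨t, rfl⟩ := hodd
    trans (k : ℚ) = t
    · push_cast
      constructor <;> intro h <;> linarith
    · rw [Nat.cast_inj]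
      omega
  · obtain ⟨t, rfl⟩ := heven
    have key : ∀ k : Fin (t + t), joinTime (SimpleGraph.pathGraph (t + t)) k =
        (((t + t : ℕ) : ℚ) ^ 3 - 3 * ((t + t : ℕ) : ℚ) ^ 2 + 5 * ((t + t : ℕ) : ℚ)) / 3 - 1 +
          4 * (((t + t : ℕ) : ℚ) - 1) * (((k : ℤ) - t) * ((k : ℤ) + 1 - t) : ℤ) := by
      intro k
      rw [joinTime_pathGraph_eq]
      push_cast
      ring
    refine ⟨fun k => ?_, fun k => ?_⟩
    · have hk : (0 : ℤ) ≤ ((k : ℤ) - t) * ((k : ℤ) + 1 - t) := by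
        rcases le_or_gt (t : ℤ) k with h | h
        · exact mul_nonneg (by omega) (by omega)
        · exact mul_nonneg_of_nonpos_of_nonpos (by omega) (by omega)
      have := mul_nonneg (mul_nonneg (zero_le_four (α := ℚ)) hn'.le) (Int.cast_nonneg (R := ℚ) hk)
      rw [key]
      linarith
    · rw [key, add_eq_left, mul_eq_zero, or_iff_right (mul_pos four_pos hn').ne', Int.cast_eq_zero,
        mul_eq_zero]
      omega
end

section
/- Let n, d be integers with 2 ≤ d ≤ n−1, and let G be a lever of order n and diameter d with fulcrum x = v_k. If d is odd, then J(x) ≥ n − 1 + (d³ − d)/3, and if d is even, then J(x) ≥ n − 1 + (d³ − 4d)/3; in each case equality holds if and only if G is isomorphic to the balanced lever L_{n,d} (with x the fulcrum of L_{n,d}). -/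
open Finset
open scoped Classical

namespace SimpleGraph

/-- A function on pairs that is `0` on the diagonal, grows by at most one along each edge and can
be decreased by moving to a neighbour computes the graph distance. -/
theorem dist_eq_of_forall_adj {V : Type*} {G : SimpleGraph V} (D : V → V → ℕ)
    (hself : ∀ u, D u u = 0)
    (hadj : ∀ u v w, G.Adj v w → D u w ≤ D u v + 1)
    (hstep : ∀ u v, u ≠ v → ∃ w, G.Adj w v ∧ D u w + 1 = D u v) (u v : V) :
    G.dist u v = D u v := by
  have hwalk : ∀ m v, D u v = m → ∃ p : G.Walk u v, p.length = m := by
    intro m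
    induction m with
    | zero =>
      intro v hv
      by_cases h : u = v
      · subst h; exact ⟨.nil, rfl⟩
      · obtain ⟨w, -, hw⟩ := hstep u v h
        omega
    | succ m ih =>
      intro v hv
      have h : u ≠ v := by
        rintro rfl
        simp [hself] at hv
      obtain ⟨w, hwv, hw⟩ := hstep u v h
      obtain ⟨p, hp⟩ := ih w (by omega)
      exact ⟨p.concat hwv, by simp [hp]⟩
  have hle : ∀ {a b : V} (p : G.Walk a b), D u b ≤ D u a + p.length := by
    intro a b p
    induction p with
    | nil => simp
    | cons h p ih =>
      have := hadj u _ _ h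
      simp only [Walk.length_cons]
      omega
  obtain ⟨p, hp⟩ := hwalk _ v rfl
  obtain ⟨q, hq⟩ := p.reachable.exists_walk_length_eq_dist
  have h1 := dist_le p
  have h2 := hle q
  rw [hself] at h2
  omega

theorem Iso.dist_map {V W : Type*} {G : SimpleGraph V} {H : SimpleGraph W} (φ : G ≃g H)
    (u v : V) : H.dist (φ u) (φ v) = G.dist u v := by
  by_cases h : G.Reachable u v
  · apply le_antisymm
    · obtain ⟨p, hp⟩ := h.exists_walk_length_eq_dist
      rw [← hp]
      exact (dist_le (p.map φ.toHom)).trans_eq (Walk.length_map _ _)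
    · obtain ⟨p, hp⟩ := (φ.reachable_iff.2 h).exists_walk_length_eq_dist
      rw [← hp]
      have := dist_le (p.map φ.symm.toHom)
      simpa using this
  · rw [dist_eq_zero_of_not_reachable h,
      dist_eq_zero_of_not_reachable (by rwa [φ.reachable_iff])]

end SimpleGraph

theorem gdeg_map_iso {V W : Type*} [Fintype V] [Fintype W] {G : SimpleGraph V}
    {H : SimpleGraph W} (φ : G ≃g H) (v : V) : gdeg H (φ v) = gdeg G v := by
  unfold gdeg
  symm
  refine Finset.card_equiv φ.toEquiv fun u => ?_
  simp [φ.map_adj_iff]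

theorem joinTime_map_iso {V W : Type*} [Fintype V] [Fintype W] {G : SimpleGraph V}
    {H : SimpleGraph W} (φ : G ≃g H) (w : V) : joinTime H (φ w) = joinTime G w := by
  unfold joinTime hitTime ell
  symm
  refine Fintype.sum_equiv φ.toEquiv _ _ fun u => ?_
  congr 1
  · exact congrArg _ (gdeg_map_iso φ u).symm
  refine Fintype.sum_equiv φ.toEquiv _ _ fun v => ?_
  simp [← φ.dist_map, ← gdeg_map_iso φ]

theorem leverGraph_adj {n d k : ℕ} {i j : Fin n} (hkd : k ≤ d) :
    (leverGraph n d k).Adj i j ↔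
      ((i.val + 1 = j.val ∧ j.val ≤ d) ∨ (i.val = k ∧ d < j.val)) ∨
      ((j.val + 1 = i.val ∧ i.val ≤ d) ∨ (j.val = k ∧ d < i.val)) := by
  rw [leverGraph, SimpleGraph.fromRel_adj, Ne, Fin.ext_iff]
  omega

/-- The reflection of the path of a lever. -/
def leverReverse (n d k : ℕ) (hkd : k ≤ d) (hdn : d < n) :
    leverGraph n d k ≃g leverGraph n d (d - k) where
  toFun i := if i.val ≤ d then ⟨d - i.val, by omega⟩ else i
  invFun i := if i.val ≤ d then ⟨d - i.val, by omega⟩ else i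
  left_inv i := by ext; grind
  right_inv i := by ext; grind
  map_rel_iff' {i j} := by
    rw [leverGraph_adj hkd, leverGraph_adj (Nat.sub_le _ _)]
    simp only [Equiv.coe_fn_mk]
    grind

theorem leverGraph_dist {n d k : ℕ} (hkd : k ≤ d) (hdn : d < n) (u v : Fin n) :
    (leverGraph n d k).dist u v =
      if u = v then 0
      else if u.val ≤ d then
        if v.val ≤ d then (u.val - v.val) + (v.val - u.val)
        else (u.val - k) + (k - u.val) + 1
      else if v.val ≤ d then (v.val - k) + (k - v.val) + 1
      else 2 := by
  refine SimpleGraph.dist_eq_of_forall_adj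
    (fun u v : Fin n => if u = v then 0
      else if u.val ≤ d then
        if v.val ≤ d then (u.val - v.val) + (v.val - u.val)
        else (u.val - k) + (k - u.val) + 1
      else if v.val ≤ d then (v.val - k) + (k - v.val) + 1
      else 2) (by simp) ?_ ?_ u v
  · intro u v w h
    rw [leverGraph_adj hkd] at h
    simp only [Fin.ext_iff]
    split_ifs <;> omega
  · intro u v h
    simp only [leverGraph_adj hkd, Fin.ext_iff] at h ⊢
    by_cases hv : d < v.val
    · refine ⟨⟨k, by omega⟩, by grind, ?_⟩
      simp only
      split_ifs <;> omega
    · by_cases hu : d < u.val ∧ v.val = k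
      · refine ⟨u, by omega, ?_⟩
        split_ifs <;> omega
      · by_cases hlt : (u.val ≤ d ∧ v.val < u.val) ∨ (d < u.val ∧ v.val < k)
        · refine ⟨⟨v.val + 1, by omega⟩, by grind, ?_⟩
          simp only
          split_ifs <;> omega
        · refine ⟨⟨v.val - 1, by omega⟩, by grind, ?_⟩
          simp only
          split_ifs <;> omega

theorem gdeg_leverGraph {n d k : ℕ} (hd : 1 ≤ d) (hkd : k ≤ d) (hdn : d < n) (u : Fin n)
    (hu : u.val ≠ k) :
    gdeg (leverGraph n d k) u = if 0 < u.val ∧ u.val < d then 2 else 1 := by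
  unfold gdeg
  split_ifs with h
  · have : (univ.filter fun v => (leverGraph n d k).Adj u v) =
        {⟨u.val - 1, by omega⟩, ⟨u.val + 1, by omega⟩} := by
      ext v
      simp only [leverGraph_adj hkd, Fin.ext_iff, mem_filter, mem_univ, true_and, mem_insert,
        mem_singleton]
      omega
    rw [this, card_pair (by simp only [Ne, Fin.ext_iff]; omega)]
  · rw [card_eq_one]
    refine ⟨⟨if u.val = 0 then 1 else if u.val = d then d - 1 else k, by split_ifs <;> omega⟩, ?_⟩
    ext v
    simp only [leverGraph_adj hkd, Fin.ext_iff, mem_filter, mem_univ, true_and, mem_singleton]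
    split_ifs <;> omega

/-- In the lever with fulcrum `v_k`, the vertex `u` is separated from `v_k` by the edge that joins
`e ≠ v_k` to its neighbour nearer to `v_k`. -/
def LeverBelow (d k e u : ℕ) : Prop :=
  (e < k ∧ u ≤ e) ∨ (k < e ∧ e ≤ u ∧ u ≤ d) ∨ (d < e ∧ u = e)

theorem ell_leverGraph {n d k : ℕ} (hkd : k ≤ d) (hdn : d < n) (u v : Fin n) :
    ell (leverGraph n d k) u v ⟨k, by omega⟩ =
      ∑ e ∈ range n, (if LeverBelow d k e u then 1 else 0) *
        (if LeverBelow d k e v then 1 else 0) := by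
  have hcard : (∑ e ∈ range n, (if LeverBelow d k e u then (1 : ℚ) else 0) *
      (if LeverBelow d k e v then 1 else 0)) =
      (((range n).filter fun e => LeverBelow d k e u ∧ LeverBelow d k e v).card : ℚ) := by
    rw [card_filter]
    push_cast
    refine sum_congr rfl fun e _ => ?_
    split_ifs <;> simp_all
  have hset : ((range n).filter fun e => LeverBelow d k e u ∧ LeverBelow d k e v) =
      if u.val ≤ d ∧ v.val ≤ d then
        Ico (max u.val v.val) k ∪ Ioc k (min u.val v.val)
      else if u = v then {u.val} else ∅ := by
    ext e
    have := u.isLt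
    rw [mem_filter, mem_range]
    simp only [Fin.ext_iff, LeverBelow]
    split_ifs <;>
      simp only [mem_union, mem_Ico, mem_Ioc, mem_singleton, notMem_empty,
        iff_false] <;> omega
  have hdisj : Disjoint (Ico (max u.val v.val) k) (Ioc k (min u.val v.val)) :=
    disjoint_left.2 fun e => by simp only [mem_Ico, mem_Ioc]; omega
  have hnat : (leverGraph n d k).dist u ⟨k, by omega⟩ + (leverGraph n d k).dist v ⟨k, by omega⟩ =
      (leverGraph n d k).dist u v +
        2 * ((range n).filter fun e => LeverBelow d k e u ∧ LeverBelow d k e v).card := by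
    rw [hset, leverGraph_dist hkd hdn, leverGraph_dist hkd hdn, leverGraph_dist hkd hdn]
    simp only [Fin.ext_iff]
    split_ifs <;> simp only [card_union_of_disjoint hdisj, Nat.card_Ico, Nat.card_Ioc,
      card_singleton, card_empty] <;> omega
  rw [hcard, ell]
  have : (_ : ℚ) = _ := congrArg Nat.cast hnat
  push_cast at this
  linarith

theorem sum_gdeg_leverBelow {n d k : ℕ} (hkd : k ≤ d) (hd : 1 ≤ d) (hdn : d < n) (e : ℕ)
    (he : e < n) :
    (∑ u : Fin n, (gdeg (leverGraph n d k) u : ℚ) * if LeverBelow d k e u then 1 else 0) =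
      if e < k then 2 * (e : ℚ) + 1 else if e = k then 0
      else if e ≤ d then 2 * ((d : ℚ) - e) + 1 else 1 := by
  have hsum : (∑ u : Fin n, (gdeg (leverGraph n d k) u : ℚ) *
      if LeverBelow d k e u then 1 else 0) =
      ∑ u ∈ (range n).filter (LeverBelow d k e), if 0 < u ∧ u < d then (2 : ℚ) else 1 := by
    rw [sum_filter, ← Fin.sum_univ_eq_sum_range
      (fun u => if LeverBelow d k e u then if 0 < u ∧ u < d then (2 : ℚ) else 1 else 0)]
    refine sum_congr rfl fun u _ => ?_
    by_cases h : LeverBelow d k e u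
    · rw [gdeg_leverGraph hd hkd hdn u (by unfold LeverBelow at h; omega)]
      simp [h]
    · simp [h]
  rw [hsum]
  split_ifs with h1 h2 h3
  · have : (range n).filter (LeverBelow d k e) = range (e + 1) := by
      ext u
      simp only [LeverBelow, mem_filter, mem_range]
      omega
    rw [this, sum_range_succ', sum_congr rfl (g := fun _ => (2 : ℚ))]
    · simp [mul_comm]
    · intro u hu
      rw [mem_range] at hu
      exact if_pos (by omega)
  · rw [filter_false_of_mem, sum_empty]
    intro u _
    unfold LeverBelow
    omega
  · have : (range n).filter (LeverBelow d k e) = Ico e (d + 1) := by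
      ext u
      simp only [LeverBelow, mem_filter, mem_range, mem_Ico]
      omega
    rw [this, sum_Ico_succ_top h3, sum_congr rfl (g := fun _ => (2 : ℚ))]
    · simp [mul_comm, Nat.cast_sub h3]
    · intro u hu
      rw [mem_Ico] at hu
      exact if_pos (by omega)
  · have : (range n).filter (LeverBelow d k e) = {e} := by
      ext u
      simp only [LeverBelow, mem_filter, mem_range, mem_singleton]
      omega
    rw [this, sum_singleton, if_neg (by omega)]

theorem sum_range_odd_sq (m : ℕ) :
    ∑ i ∈ range m, (2 * (i : ℚ) + 1) ^ 2 = m * (4 * (m : ℚ) ^ 2 - 1) / 3 := by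
  induction m with
  | zero => simp
  | succ m ih => rw [sum_range_succ, ih]; push_cast; ring

theorem joinTime_leverGraph {n d k : ℕ} (hkd : k ≤ d) (hd : 1 ≤ d) (hdn : d < n) :
    joinTime (leverGraph n d k) ⟨k, by omega⟩ =
      (n : ℚ) - 1 + ((d : ℚ) ^ 3 - 4 * d) / 3 + d * ((d : ℚ) - 2 * k) ^ 2 := by
  have hsq : joinTime (leverGraph n d k) ⟨k, by omega⟩ = ∑ e ∈ range n,
      (∑ u : Fin n, (gdeg (leverGraph n d k) u : ℚ) * if LeverBelow d k e u then 1 else 0) ^ 2 := by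
    simp only [joinTime, hitTime, ell_leverGraph hkd hdn, sum_mul, mul_sum, sq]
    rw [sum_congr rfl fun u _ => sum_comm, sum_comm]
    refine sum_congr rfl fun e _ => sum_congr rfl fun u _ => sum_congr rfl fun v _ => ?_
    ring
  rw [hsq, sum_congr rfl fun e he => by rw [sum_gdeg_leverBelow hkd hd hdn e (mem_range.1 he)]]
  clear hsq
  obtain ⟨m, rfl⟩ := Nat.exists_eq_add_of_le hkd
  obtain ⟨l, rfl⟩ := Nat.exists_eq_add_of_lt hdn
  rw [show k + m + l + 1 = k + (1 + (m + l)) by ring, sum_range_add, sum_range_add, sum_range_add,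
    sum_congr rfl (g := fun e : ℕ => (2 * (e : ℚ) + 1) ^ 2)
      fun e he => by rw [if_pos (mem_range.1 he)],
    sum_range_one, if_neg (by omega), if_pos (by omega),
    sum_congr (s₁ := range m) rfl (g := fun e : ℕ => (2 * ((m - 1 - e : ℕ) : ℚ) + 1) ^ 2)
      fun e he => by
        rw [mem_range] at he
        rw [if_neg (by omega), if_neg (by omega), if_pos (by omega), Nat.sub_sub,
          Nat.cast_sub (by omega)]
        push_cast
        ring,
    sum_range_reflect (fun e : ℕ => (2 * (e : ℚ) + 1) ^ 2) m,
    sum_congr (s₁ := range l) rfl (g := fun _ : ℕ => (1 : ℚ))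
      fun e _ => by rw [if_neg (by omega), if_neg (by omega), if_neg (by omega), one_pow],
    sum_range_odd_sq, sum_range_odd_sq, sum_const, card_range]
  push_cast
  simp only [nsmul_eq_mul]
  ring

theorem exists_iso_balancedLever_iff {n d k : ℕ} (hd : 2 ≤ d) (hkd : k ≤ d) (hdn : d < n) :
    (∃ φ : leverGraph n d k ≃g balancedLever n d, φ ⟨k, by omega⟩ = ⟨d / 2, by omega⟩) ↔
      k = d / 2 ∨ d - k = d / 2 := by
  constructor
  · rintro ⟨φ, hφ⟩
    have h := joinTime_map_iso φ ⟨k, by omega⟩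
    rw [hφ, joinTime_leverGraph hkd (by omega) hdn, balancedLever,
      joinTime_leverGraph (Nat.div_le_self _ _) (by omega) hdn, add_right_inj,
      mul_right_inj' (by positivity), sq_eq_sq_iff_eq_or_eq_neg] at h
    obtain h | h := h
    · left
      have : (k : ℚ) = (d / 2 : ℕ) := by linarith
      exact_mod_cast this
    · right
      have : (d : ℚ) = (d / 2 : ℕ) + k := by linarith
      have : d = d / 2 + k := by exact_mod_cast this
      omega
  · rintro (rfl | h)
    · exact ⟨SimpleGraph.Iso.refl, rfl⟩
    · suffices ∀ (j : ℕ) (hj : j < n), d - k = j →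
          ∃ φ : leverGraph n d k ≃g leverGraph n d j, φ ⟨k, by omega⟩ = ⟨j, hj⟩ from this _ _ h
      rintro _ _ rfl
      exact ⟨leverReverse n d k hkd hdn, if_pos hkd⟩

/-- among levers of order `n` and diameter `d`, the joining time to the
fulcrum is minimized exactly by the balanced lever. -/
theorem lever_join_time (n d k : ℕ) (hd2 : 2 ≤ d) (hdn : d ≤ n - 1)
    (hk1 : 1 ≤ k) (hk2 : k ≤ d - 1) :
    (Odd d →
      (n : ℚ) - 1 + ((d : ℚ)^3 - (d : ℚ))/3 ≤
        joinTime (leverGraph n d k) ⟨k, by omega⟩ ∧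
      (joinTime (leverGraph n d k) ⟨k, by omega⟩ =
          (n : ℚ) - 1 + ((d : ℚ)^3 - (d : ℚ))/3 ↔
        ∃ φ : leverGraph n d k ≃g balancedLever n d,
          φ ⟨k, by omega⟩ = ⟨d/2, by omega⟩)) ∧
    (Even d →
      (n : ℚ) - 1 + ((d : ℚ)^3 - 4*(d : ℚ))/3 ≤
        joinTime (leverGraph n d k) ⟨k, by omega⟩ ∧
      (joinTime (leverGraph n d k) ⟨k, by omega⟩ =
          (n : ℚ) - 1 + ((d : ℚ)^3 - 4*(d : ℚ))/3 ↔
        ∃ φ : leverGraph n d k ≃g balancedLever n d,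
          φ ⟨k, by omega⟩ = ⟨d/2, by omega⟩)) := by
  have hkd : k ≤ d := by omega
  have hlt : d < n := by omega
  have hd0 : (0 : ℚ) < d := by positivity
  rw [exists_iso_balancedLever_iff hd2 hkd hlt, joinTime_leverGraph hkd (by omega) hlt]
  constructor
  · intro hd
    obtain ⟨m, hm⟩ := hd
    have hge : (1 : ℚ) ≤ ((d : ℚ) - 2 * k) ^ 2 := by
      have : (1 : ℤ) ≤ ((d : ℤ) - 2 * k) ^ 2 := (one_le_sq_iff_one_le_abs _).2 (Int.one_le_abs (by omega))
      exact_mod_cast this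
    have hiff : ((d : ℚ) - 2 * k) ^ 2 = 1 ↔ k = d / 2 ∨ d - k = d / 2 := by
      have : ((d : ℤ) - 2 * k) ^ 2 = 1 ↔ k = d / 2 ∨ d - k = d / 2 := by
        rw [sq_eq_one_iff]
        omega
      exact_mod_cast this
    refine ⟨by nlinarith, ?_⟩
    rw [← hiff]
    exact ⟨fun h => mul_left_cancel₀ hd0.ne' (by linarith), fun h => by rw [h]; ring⟩
  · intro hd
    obtain ⟨m, hm⟩ := hd
    have hiff : ((d : ℚ) - 2 * k) ^ 2 = 0 ↔ k = d / 2 ∨ d - k = d / 2 := by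
      have : ((d : ℤ) - 2 * k) ^ 2 = 0 ↔ k = d / 2 ∨ d - k = d / 2 := by
        rw [sq_eq_zero_iff]
        omega
      exact_mod_cast this
    refine ⟨le_add_of_nonneg_right (by positivity), ?_⟩
    rw [← hiff, add_eq_left, mul_eq_zero_iff_left hd0.ne']
end

section
/- Let n, d be integers with 2 ≤ d ≤ n−1. For every tree G of order n with diameter d, J_min(G) ≥ J_min(L_{n,d}), and equality holds if and only if G is isomorphic to the balanced lever L_{n,d}. -/
open Finset
open scoped Classical

namespace SimpleGraph

variable {V : Type*} {G : SimpleGraph V}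

lemma Connected.exists_adj_dist_add_one (hG : G.Connected) {u w : V} (h : u ≠ w) :
    ∃ p, G.Adj u p ∧ G.dist w u = G.dist w p + 1 := by
  obtain ⟨q, hq⟩ := hG.exists_walk_length_eq_dist u w
  cases q with
  | nil => exact absurd rfl h
  | @cons _ p _ hadj q =>
    refine ⟨p, hadj, ?_⟩
    have h₁ := G.dist_le q
    have h₂ := hG.dist_triangle (u := u) (v := p) (w := w)
    rw [Walk.length_cons] at hq
    rw [dist_eq_one_iff_adj.2 hadj] at h₂
    rw [G.dist_comm (u := w) (v := u), G.dist_comm (u := w) (v := p)]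
    omega

/-- In a tree, the geodesic between vertices on different sides of an edge uses that edge. -/
lemma IsTree.dist_eq_of_adj_between (hG : G.IsTree) {u p v w : V} (hup : G.Adj u p)
    (hw : G.dist w u = G.dist w p + 1) (hv : G.dist v p = G.dist v u + 1) :
    G.dist w v = G.dist w u + G.dist u v := by
  obtain ⟨a, ha, hal⟩ := hG.connected.exists_path_of_dist w p
  obtain ⟨b, hb, hbl⟩ := hG.connected.exists_path_of_dist u v
  have hsplit : ∀ {x y z : V} (q : G.Walk x y), q.length = G.dist x y → z ∈ q.support →
      G.dist x y = G.dist x z + G.dist z y := by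
    intro x y z q hq hz
    have h₁ := congrArg Walk.length (q.take_spec hz)
    rw [Walk.length_append] at h₁
    have h₂ := G.dist_le (q.takeUntil z hz)
    have h₃ := G.dist_le (q.dropUntil z hz)
    have h₄ := hG.connected.dist_triangle (u := x) (v := z) (w := y)
    omega
  have hpath : (a.append (Walk.cons hup.symm b)).IsPath := by
    rw [Walk.isPath_def, Walk.support_append, Walk.support_cons, List.tail_cons,
      List.nodup_append']
    refine ⟨ha.support_nodup, hb.support_nodup, fun z hza hzb => ?_⟩
    have h₁ := hsplit a hal hza
    have h₂ := hsplit b hbl hzb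
    have h₃ := hG.connected.dist_triangle (u := w) (v := z) (w := u)
    have h₄ := hG.connected.dist_triangle (u := p) (v := z) (w := v)
    rw [G.dist_comm (u := p) (v := v), G.dist_comm (u := p) (v := z)] at h₄
    rw [G.dist_comm (u := u) (v := v), G.dist_comm (u := u) (v := z)] at h₂
    omega
  obtain ⟨c, hc, hcl⟩ := hG.connected.exists_path_of_dist w v
  have := hG.existsUnique_path w v |>.unique hc hpath
  rw [← hcl, this, Walk.length_append, Walk.length_cons, hal, hbl, hw]
  omega

/-- The vertices whose geodesic to `w` passes through `x`. -/
noncomputable def cone [Fintype V] (G : SimpleGraph V) (w x : V) : Finset V :=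
  Finset.univ.filter fun y => G.dist w y = G.dist w x + G.dist x y

section Cone

variable [Fintype V] {u v w x y p : V}

lemma mem_cone : y ∈ G.cone w x ↔ G.dist w y = G.dist w x + G.dist x y := by simp [cone]

lemma self_mem_cone : x ∈ G.cone w x := by simp [mem_cone]

lemma IsTree.mem_cone_iff_of_adj (hG : G.IsTree) (hup : G.Adj u p)
    (hw : G.dist w u = G.dist w p + 1) :
    u ∈ G.cone w x ↔ x = u ∨ p ∈ G.cone w x := by
  constructor
  · intro h
    rw [or_iff_not_imp_left]
    intro hxu
    rw [mem_cone] at h ⊢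
    rcases hG.dist_eq_dist_add_one_of_adj x hup with hx | hx
    · omega
    · have h₁ := hG.dist_eq_of_adj_between hup hw hx
      have h₂ : G.dist u x ≠ 0 := fun h₀ => hxu (hG.connected.dist_eq_zero_iff.1 h₀).symm
      omega
  · rintro (rfl | h)
    · exact self_mem_cone
    · rw [mem_cone] at h ⊢
      have h₁ := hG.connected.dist_triangle (u := w) (v := x) (w := u)
      have h₂ := hG.connected.dist_triangle (u := x) (v := p) (w := u)
      rw [dist_eq_one_iff_adj.2 hup.symm] at h₂
      omega

lemma IsTree.eq_of_adj_of_dist (hG : G.IsTree) {q : V} (hup : G.Adj u p) (huq : G.Adj u q)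
    (hp : G.dist w u = G.dist w p + 1) (hq : G.dist w u = G.dist w q + 1) : p = q := by
  have h : u ∈ G.cone w q := (hG.mem_cone_iff_of_adj huq hq).2 (Or.inr self_mem_cone)
  rcases (hG.mem_cone_iff_of_adj hup hp).1 h with h | h
  · exact absurd h.symm huq.ne
  · rw [mem_cone] at h
    exact (hG.connected.dist_eq_zero_iff.1 (by omega)).symm

lemma IsTree.dist_add_one_of_notMem_cone (hG : G.IsTree) (hup : G.Adj u p)
    (hw : G.dist w u = G.dist w p + 1) (hv : v ∉ G.cone w u) :
    G.dist v u = G.dist v p + 1 :=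
  (hG.dist_eq_dist_add_one_of_adj v hup).resolve_right fun h =>
    hv (mem_cone.2 (hG.dist_eq_of_adj_between hup hw h))

lemma IsTree.dist_add_one_of_mem_cone (hG : G.IsTree) (hup : G.Adj u p)
    (hw : G.dist w u = G.dist w p + 1) (hv : v ∈ G.cone w u) :
    G.dist v p = G.dist v u + 1 := by
  refine (hG.dist_eq_dist_add_one_of_adj v hup).resolve_left fun h => ?_
  have h₁ := hG.connected.dist_triangle (u := w) (v := p) (w := v)
  rw [mem_cone] at hv
  rw [G.dist_comm (u := v) (v := u), G.dist_comm (u := v) (v := p)] at h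
  omega

/-- `ℓ(u, v; w)` counts the edges shared by the geodesics from `u` and from `v` to `w`. -/
lemma IsTree.ell_eq_card (hG : G.IsTree) (u v w : V) :
    ell G u v w =
      ((univ.erase w).filter fun x => u ∈ G.cone w x ∧ v ∈ G.cone w x).card := by
  induction h : G.dist w u generalizing u with
  | zero =>
    obtain rfl := hG.connected.dist_eq_zero_iff.1 h
    have : ((univ.erase w).filter fun x => w ∈ G.cone w x ∧ v ∈ G.cone w x) = ∅ := by
      rw [filter_eq_empty_iff]
      rintro x hx ⟨h₁, -⟩
      rw [mem_cone, dist_self] at h₁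
      exact (mem_erase.1 hx).1 (hG.connected.dist_eq_zero_iff.1 (by omega)).symm
    rw [this, ell, G.dist_comm (u := v) (v := w)]
    simp
  | succ m ih =>
    have huw : u ≠ w := by rintro rfl; simp at h
    obtain ⟨p, hup, hp⟩ := hG.connected.exists_adj_dist_add_one huw
    have ih := ih p (by omega)
    have hset : ((univ.erase w).filter fun x => u ∈ G.cone w x ∧ v ∈ G.cone w x) =
        if v ∈ G.cone w u then
          insert u ((univ.erase w).filter fun x => p ∈ G.cone w x ∧ v ∈ G.cone w x)
        else (univ.erase w).filter fun x => p ∈ G.cone w x ∧ v ∈ G.cone w x := by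
      ext x
      split_ifs with hv <;>
      · simp only [mem_filter, mem_erase, mem_univ, and_true, mem_insert,
          hG.mem_cone_iff_of_adj hup hp]
        by_cases hx : x = u
        · subst hx; simp [huw, hv]
        · simp [hx]
    have hpu : p ∉ G.cone w u := by rw [mem_cone]; omega
    have hwp : (G.dist u w : ℚ) = G.dist p w + 1 := by
      rw [G.dist_comm (u := u), G.dist_comm (u := p)]; exact_mod_cast hp
    rw [hset]
    split_ifs with hv
    · rw [card_insert_of_notMem (by simp [hpu]), Nat.cast_succ, ← ih, ell, ell, hwp]
      have : (G.dist p v : ℚ) = G.dist u v + 1 := by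
        rw [G.dist_comm (u := u), G.dist_comm (u := p)]
        exact_mod_cast hG.dist_add_one_of_mem_cone hup hp hv
      rw [this]; ring
    · rw [← ih, ell, ell, hwp]
      have : (G.dist u v : ℚ) = G.dist p v + 1 := by
        rw [G.dist_comm (u := u), G.dist_comm (u := p)]
        exact_mod_cast hG.dist_add_one_of_notMem_cone hup hp hv
      rw [this]; ring

lemma IsTree.sum_gdeg_cone (hG : G.IsTree) (hx : x ≠ w) :
    ∑ u ∈ G.cone w x, gdeg G u + 1 = 2 * (G.cone w x).card := by
  have hdeg : ∀ u, gdeg G u =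
      (univ.filter fun v => G.Adj u v ∧ G.dist w u = G.dist w v + 1).card +
      (univ.filter fun v => G.Adj u v ∧ G.dist w v = G.dist w u + 1).card := by
    intro u
    rw [gdeg, ← card_union_of_disjoint]
    · congr 1
      ext v
      simp only [mem_filter, mem_univ, true_and, mem_union]
      have := fun h : G.Adj u v => hG.dist_eq_dist_add_one_of_adj w h
      tauto
    · rw [disjoint_filter]
      rintro v - ⟨-, h₁⟩ ⟨-, h₂⟩
      omega
  have hpar : ∀ u ≠ w,
      (univ.filter fun v => G.Adj u v ∧ G.dist w u = G.dist w v + 1).card = 1 := by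
    intro u hu
    obtain ⟨p, hup, hp⟩ := hG.connected.exists_adj_dist_add_one hu
    rw [card_eq_one]
    refine ⟨p, ?_⟩
    ext v
    simp only [mem_filter, mem_univ, true_and, mem_singleton]
    exact ⟨fun h => hG.eq_of_adj_of_dist h.1 hup h.2 hp, by rintro rfl; exact ⟨hup, hp⟩⟩
  have hw : w ∉ G.cone w x := by
    rw [mem_cone, dist_self]
    intro h
    exact hx (hG.connected.dist_eq_zero_iff.1 (by omega)).symm
  have hsum₁ : ∑ u ∈ G.cone w x,
      (univ.filter fun v => G.Adj u v ∧ G.dist w u = G.dist w v + 1).card =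
      (G.cone w x).card := by
    rw [sum_congr rfl fun u hu => hpar u (by rintro rfl; exact hw hu)]
    simp
  have hsum₂ : ∑ u ∈ G.cone w x,
      (univ.filter fun v => G.Adj u v ∧ G.dist w v = G.dist w u + 1).card =
      ((G.cone w x).erase x).card := by
    have hcomm := sum_card_bipartiteAbove_eq_sum_card_bipartiteBelow
      (s := G.cone w x) (t := univ)
      (fun u v => G.Adj u v ∧ G.dist w v = G.dist w u + 1)
    refine hcomm.trans ?_
    rw [card_eq_sum_ones, ← sum_filter_add_sum_filter_not univ (· ∈ (G.cone w x).erase x)]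
    rw [filter_mem_eq_inter, univ_inter, sum_eq_zero (s := filter _ _), add_zero]
    · refine sum_congr rfl fun v hv => ?_
      rw [mem_erase] at hv
      obtain ⟨p, hvp, hp⟩ := hG.connected.exists_adj_dist_add_one
        (u := v) (w := w) (by rintro rfl; exact hw hv.2)
      rw [card_eq_one]
      refine ⟨p, ?_⟩
      ext u
      simp only [mem_bipartiteBelow, mem_singleton]
      refine ⟨fun h => hG.eq_of_adj_of_dist h.2.1.symm hvp h.2.2 hp, ?_⟩
      rintro rfl
      exact ⟨((hG.mem_cone_iff_of_adj hvp hp).1 hv.2).resolve_left (Ne.symm hv.1), hvp.symm, hp⟩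
    · intro v hv
      rw [mem_filter] at hv
      rw [card_eq_zero, eq_empty_iff_forall_notMem]
      intro u hu
      rw [mem_bipartiteBelow] at hu
      obtain ⟨hu, huv, hd⟩ := hu
      refine hv.2 (mem_erase.2 ⟨?_, (hG.mem_cone_iff_of_adj huv.symm hd).2 (Or.inr hu)⟩)
      rintro rfl
      rw [mem_cone] at hu
      omega
  rw [sum_congr rfl fun u _ => hdeg u, sum_add_distrib, hsum₁, hsum₂,
    add_assoc, card_erase_add_one self_mem_cone, two_mul]

lemma IsTree.joinTime_eq (hG : G.IsTree) (w : V) :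
    joinTime G w = ∑ x ∈ univ.erase w, (2 * ((G.cone w x).card : ℚ) - 1) ^ 2 := by
  have hstep : joinTime G w =
      ∑ x ∈ univ.erase w, (∑ u ∈ G.cone w x, (gdeg G u : ℚ)) ^ 2 := by
    have h₁ : joinTime G w = ∑ u, ∑ v, ∑ x ∈ univ.erase w,
        if u ∈ G.cone w x ∧ v ∈ G.cone w x then (gdeg G u : ℚ) * gdeg G v else 0 := by
      simp only [joinTime, hitTime, hG.ell_eq_card, mul_sum]
      refine sum_congr rfl fun u _ => sum_congr rfl fun v _ => ?_
      rw [← sum_filter, sum_const, nsmul_eq_mul]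
      ring
    rw [h₁]
    simp_rw [sum_comm (t := univ.erase w)]
    refine sum_congr rfl fun x _ => ?_
    rw [sq, sum_mul_sum, ← sum_filter_add_sum_filter_not univ (· ∈ G.cone w x),
      filter_mem_eq_inter, univ_inter, sum_eq_zero (s := filter _ _), add_zero]
    · refine sum_congr rfl fun u hu => ?_
      rw [← sum_filter]
      simp [hu]
    · intro u hu
      simp [(mem_filter.1 hu).2]
  rw [hstep]
  refine sum_congr rfl fun x hx => ?_
  congr 1
  have := hG.sum_gdeg_cone (mem_erase.1 hx).1
  rw [eq_sub_iff_add_eq]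
  exact_mod_cast this

end Cone

/-- `P 0, …, P d` is a geodesic. -/
def IsGeodesic (G : SimpleGraph V) (P : ℕ → V) (d : ℕ) : Prop :=
  ∀ ⦃i j⦄, i ≤ j → j ≤ d → i + G.dist (P i) (P j) = j

section Geodesic

variable {P : ℕ → V} {d i j k : ℕ} {w x : V}

lemma IsGeodesic.dist_eq (hP : G.IsGeodesic P d) (hi : i ≤ d) (hj : j ≤ d) :
    (G.dist (P i) (P j) : ℤ) = |(i : ℤ) - j| := by
  rcases le_total i j with h | h
  · have := hP h hj
    rw [abs_of_nonpos (by omega)]; omega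
  · have := hP h hi
    rw [G.dist_comm, abs_of_nonneg (by omega)]; omega

lemma IsGeodesic.adj_iff (hP : G.IsGeodesic P d) (hi : i ≤ d) (hj : j ≤ d) :
    G.Adj (P i) (P j) ↔ i + 1 = j ∨ j + 1 = i := by
  rw [← dist_eq_one_iff_adj]
  have := hP.dist_eq hi hj
  rcases abs_cases ((i : ℤ) - j) with h | h <;> omega

lemma IsGeodesic.injOn (hP : G.IsGeodesic P d) : Set.InjOn P {i | i ≤ d} := by
  intro i hi j hj hij
  have := hP.dist_eq hi hj
  rw [hij, dist_self] at this
  have := abs_eq_zero.1 this.symm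
  omega

lemma IsGeodesic.reverse (hP : G.IsGeodesic P d) : G.IsGeodesic (fun i => P (d - i)) d := by
  intro i j hij hj
  have := hP (i := d - j) (j := d - i) (by omega) (by omega)
  rw [G.dist_comm] at this
  change i + G.dist (P (d - i)) (P (d - j)) = j
  omega

lemma Connected.isGeodesic_of_adj (hG : G.Connected) (hadj : ∀ i < d, G.Adj (P i) (P (i + 1)))
    (hd : d ≤ G.dist (P 0) (P d)) : G.IsGeodesic P d := by
  have hle : ∀ i m, i + m ≤ d → G.dist (P i) (P (i + m)) ≤ m := by
    intro i m
    induction m with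
    | zero => simp
    | succ m ih =>
      intro h
      have h₁ := ih (by omega)
      have h₂ := hG.dist_triangle (u := P i) (v := P (i + m)) (w := P (i + m + 1))
      rw [dist_eq_one_iff_adj.2 (hadj (i + m) (by omega))] at h₂
      rw [← add_assoc]
      omega
  intro i j hij hj
  have h₁ := hle 0 i (by omega)
  have h₂ := hle i (j - i) (by omega)
  have h₃ := hle j (d - j) (by omega)
  rw [zero_add] at h₁
  rw [Nat.add_sub_cancel' hij] at h₂
  rw [Nat.add_sub_cancel' hj] at h₃
  have h₄ := hG.dist_triangle (u := P 0) (v := P i) (w := P j)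
  have h₅ := hG.dist_triangle (u := P 0) (v := P j) (w := P d)
  omega

lemma Connected.exists_isGeodesic_gdiam [Fintype V] (hG : G.Connected) :
    ∃ P, G.IsGeodesic P (gdiam G) := by
  have := hG.nonempty
  obtain ⟨⟨a, b⟩, -, hab⟩ := exists_mem_eq_sup (univ : Finset (V × V)) univ_nonempty
    fun p => G.dist p.1 p.2
  obtain ⟨q, hq⟩ := hG.exists_walk_length_eq_dist a b
  have hd : gdiam G = q.length := hab.trans hq.symm
  refine ⟨q.getVert, ?_⟩
  rw [hd]
  refine hG.isGeodesic_of_adj (fun i hi => q.adj_getVert_succ hi) ?_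
  rw [Walk.getVert_zero, Walk.getVert_length, hq]

lemma IsTree.dist_geodesic_of_forall_le [Fintype V] (hG : G.IsTree) (hP : G.IsGeodesic P d)
    (hmin : ∀ i ≤ d, G.dist w (P k) ≤ G.dist w (P i)) (m : ℕ) (hm : k + m ≤ d) :
    G.dist w (P (k + m)) = G.dist w (P k) + m := by
  induction m using Nat.strong_induction_on with
  | _ m ih =>
    match m with
    | 0 => rfl
    | 1 =>
      have hadj := (hP.adj_iff (i := k) (j := k + 1) (by omega) hm).2 (Or.inl rfl)
      have := hG.dist_eq_dist_add_one_of_adj w hadj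
      have := hmin (k + 1) hm
      omega
    | m + 2 =>
      have h₀ := ih m (by omega) (by omega)
      have h₁ := ih (m + 1) (by omega) (by omega)
      have hadj₀ := (hP.adj_iff (i := k + (m + 1)) (j := k + m)
        (by omega) (by omega)).2 (by omega)
      have hadj₁ := (hP.adj_iff (i := k + (m + 1)) (j := k + (m + 2))
        (by omega) (by omega)).2 (by omega)
      rcases hG.dist_eq_dist_add_one_of_adj w hadj₁ with h | h
      · have := hG.eq_of_adj_of_dist hadj₀ hadj₁ (by omega) h
        have := hP.injOn (show k + m ≤ d by omega) hm this
        omega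
      · omega

/-- Every vertex has a gate on a geodesic of a tree. -/
lemma IsTree.exists_gate [Fintype V] (hG : G.IsTree) (hP : G.IsGeodesic P d) (w : V) :
    ∃ k ≤ d, ∀ i ≤ d, G.dist w (P i) = G.dist w (P k) + G.dist (P k) (P i) := by
  obtain ⟨k, hk, hmin⟩ := exists_min_image (range (d + 1)) (fun i => G.dist w (P i)) ⟨0, by simp⟩
  simp only [mem_range, Order.lt_add_one_iff] at hk hmin
  refine ⟨k, hk, fun i hi => ?_⟩
  rcases le_total k i with h | h
  · have h₁ := hG.dist_geodesic_of_forall_le hP hmin (i - k) (by omega)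
    have h₂ := hP h hi
    rw [Nat.add_sub_cancel' h] at h₁
    omega
  · have hk' : d - (d - k) = k := by omega
    have h₁ := hG.dist_geodesic_of_forall_le (w := w) (k := d - k) hP.reverse
      (fun j _ => by rw [hk']; exact hmin (d - j) (by omega)) (k - i) (by omega)
    have h₂ := hP h hk
    rw [hk', show d - (d - k + (k - i)) = i by omega] at h₁
    rw [G.dist_comm] at h₂
    omega

lemma IsTree.dist_leaf [Fintype V] (hG : G.IsTree) (hP : G.IsGeodesic P d) (hk : k ≤ d)
    (hx : ∀ i ≤ d, P i ≠ x) (hadj : G.Adj (P k) x) (hi : i ≤ d) :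
    G.dist x (P i) = 1 + G.dist (P k) (P i) := by
  obtain ⟨l, hl, hgate⟩ := hG.exists_gate hP x
  have h₁ := hgate k hk
  rw [dist_eq_one_iff_adj.2 hadj.symm] at h₁
  have h₂ := hG.connected.pos_dist_of_ne (hx l hl).symm
  obtain rfl : l = k := hP.injOn hl hk (hG.connected.dist_eq_zero_iff.1 (by omega))
  have := hgate i hi
  rwa [dist_eq_one_iff_adj.2 hadj.symm] at this

end Geodesic

/-- The number of vertices in the branch of the path `0, …, d` rooted at `k` hanging from `i`. -/
def pathBranchSize (d k i : ℕ) : ℕ := if i < k then i + 1 else d - i + 1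

/-- The vertices of the path `0, …, d` rooted at `k` in the branch hanging from `i`. -/
def pathBranch (d k i : ℕ) : Finset ℕ := if i < k then range (i + 1) else Icc i d

lemma card_pathBranch {d k i : ℕ} (hi : i ≤ d) :
    (pathBranch d k i).card = pathBranchSize d k i := by
  unfold pathBranch pathBranchSize
  split_ifs
  · simp
  · rw [Nat.card_Icc]; omega

lemma IsGeodesic.card_image_pathBranch {P : ℕ → V} {d i k : ℕ} (hP : G.IsGeodesic P d)
    (hi : i ≤ d) :
    ((pathBranch d k i).image P).card = pathBranchSize d k i := by
  rw [card_image_of_injOn, card_pathBranch hi]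
  refine hP.injOn.mono fun j hj => ?_
  rw [mem_coe] at hj
  change j ≤ d
  unfold pathBranch at hj
  split_ifs at hj
  · rw [mem_range] at hj; omega
  · exact (mem_Icc.1 hj).2

lemma sq_two_mul_sub_one_le {a b : ℕ} (ha : 1 ≤ a) (hab : a ≤ b) :
    (2 * (a : ℚ) - 1) ^ 2 ≤ (2 * (b : ℚ) - 1) ^ 2 := by
  have ha : (1 : ℚ) ≤ a := by exact_mod_cast ha
  have hab : (a : ℚ) ≤ b := by exact_mod_cast hab
  gcongr
  linarith

lemma le_of_sq_two_mul_sub_one_eq {a b : ℕ} (ha : 1 ≤ a) (hab : a ≤ b)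
    (h : (2 * (a : ℚ) - 1) ^ 2 = (2 * (b : ℚ) - 1) ^ 2) : b ≤ a := by
  have ha : (1 : ℚ) ≤ a := by exact_mod_cast ha
  have hab : (a : ℚ) ≤ b := by exact_mod_cast hab
  have : (b : ℚ) ≤ a := by nlinarith
  exact_mod_cast this

/-- The joining time of a lever of order `n` and diameter `d` to its fulcrum `v_k`. -/
def leverTime (n d k : ℕ) : ℚ :=
  ∑ i ∈ (range (d + 1)).erase k, (2 * (pathBranchSize d k i : ℚ) - 1) ^ 2 + ((n : ℚ) - 1 - d)

section LeverTime

variable [Fintype V] {P : ℕ → V} {d i k : ℕ} {w x : V}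

lemma IsGeodesic.image_pathBranch_subset_cone (hP : G.IsGeodesic P d) (hk : k ≤ d)
    (hgate : ∀ i ≤ d, G.dist w (P i) = G.dist w (P k) + G.dist (P k) (P i))
    (hi : i ≤ d) (hik : i ≠ k) : (pathBranch d k i).image P ⊆ G.cone w (P i) := by
  intro y hy
  obtain ⟨j, hj, rfl⟩ := mem_image.1 hy
  have hj' : j ≤ d ∧ (i < k ∧ j ≤ i ∨ k < i ∧ i ≤ j) := by
    unfold pathBranch at hj
    split_ifs at hj
    · rw [mem_range] at hj; omega
    · rw [mem_Icc] at hj; omega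
  have h₁ := hgate i hi
  have h₂ := hgate j hj'.1
  have h₃ := hP.dist_eq hk hi
  have h₄ := hP.dist_eq hk hj'.1
  have h₅ := hP.dist_eq hi hj'.1
  rw [mem_cone]
  rcases abs_cases ((k : ℤ) - i) with h | h <;> rcases abs_cases ((k : ℤ) - j) with h' | h' <;>
    rcases abs_cases ((i : ℤ) - j) with h'' | h'' <;> omega

lemma IsTree.joinTime_eq_geodesic_add (hG : G.IsTree) (hP : G.IsGeodesic P d) (hk : k ≤ d)
    (hgate : ∀ i ≤ d, G.dist w (P i) = G.dist w (P k) + G.dist (P k) (P i)) :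
    ∃ R : Finset V, (∀ x, x ∈ R ↔ x ≠ w ∧ ∀ i ≤ d, i ≠ k → P i ≠ x) ∧
      (R.card : ℚ) = (Fintype.card V : ℚ) - 1 - d ∧
      joinTime G w = ∑ i ∈ (range (d + 1)).erase k, (2 * ((G.cone w (P i)).card : ℚ) - 1) ^ 2 +
        ∑ x ∈ R, (2 * ((G.cone w x).card : ℚ) - 1) ^ 2 := by
  have hinj : Set.InjOn P ((range (d + 1)).erase k) :=
    hP.injOn.mono fun i hi => by
      have := mem_range.1 (mem_erase.1 (mem_coe.1 hi)).2
      exact Nat.lt_succ_iff.1 this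
  have hsub : ((range (d + 1)).erase k).image P ⊆ univ.erase w := by
    intro y hy
    obtain ⟨i, hi, rfl⟩ := mem_image.1 hy
    rw [mem_erase, mem_range] at hi
    refine mem_erase.2 ⟨fun h => hi.1 ?_, mem_univ _⟩
    have h₁ := hgate i (by omega)
    rw [h, dist_self] at h₁
    have h₂ : G.dist (P k) (P i) = 0 := by rw [h]; omega
    exact hP.injOn (show i ≤ d by omega) hk (hG.connected.dist_eq_zero_iff.1 h₂).symm
  refine ⟨univ.erase w \ ((range (d + 1)).erase k).image P, fun x => ?_, ?_, ?_⟩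
  · simp only [mem_sdiff, mem_erase, mem_univ, and_true, mem_image, mem_range,
      Order.lt_add_one_iff, not_exists, not_and, ne_eq]
    exact and_congr_right fun _ => forall_congr' fun i => by tauto
  · rw [cast_card_sdiff hsub, card_image_of_injOn hinj, card_erase_of_mem (mem_univ _),
      card_erase_of_mem (mem_range.2 (by omega)), card_range, card_univ,
      Nat.cast_pred (Fintype.card_pos_iff.2 ⟨w⟩)]
    simp
  · rw [hG.joinTime_eq, ← sum_sdiff hsub, sum_image hinj, add_comm]

lemma IsTree.leverTime_le_joinTime (hG : G.IsTree) (hP : G.IsGeodesic P d) (hd : 1 ≤ d)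
    (hk : k ≤ d)
    (hgate : ∀ i ≤ d, G.dist w (P i) = G.dist w (P k) + G.dist (P k) (P i)) :
    leverTime (Fintype.card V) d k ≤ joinTime G w ∧
      (joinTime G w = leverTime (Fintype.card V) d k →
        ∀ x, (∀ i ≤ d, P i ≠ x) → G.Adj (P k) x) := by
  obtain ⟨R, hR, hRcard, hJ⟩ := hG.joinTime_eq_geodesic_add hP hk hgate
  have hcard : ∀ i ≤ d, i ≠ k → pathBranchSize d k i ≤ (G.cone w (P i)).card :=
    fun i hi hik => (hP.card_image_pathBranch hi).ge.trans
      (card_le_card (hP.image_pathBranch_subset_cone hk hgate hi hik))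
  have hpos : ∀ i, 1 ≤ pathBranchSize d k i := by
    intro i; unfold pathBranchSize; split_ifs <;> omega
  have hpos' : ∀ x, 1 ≤ (G.cone w x).card := fun x => card_pos.2 ⟨x, self_mem_cone⟩
  have hle₁ : ∀ i ∈ (range (d + 1)).erase k, (2 * (pathBranchSize d k i : ℚ) - 1) ^ 2 ≤
      (2 * ((G.cone w (P i)).card : ℚ) - 1) ^ 2 := fun i hi => by
    rw [mem_erase, mem_range] at hi
    exact sq_two_mul_sub_one_le (hpos i) (hcard i (by omega) hi.1)
  have hle₂ : ∀ x ∈ R, (2 * ((1 : ℕ) : ℚ) - 1) ^ 2 ≤ (2 * ((G.cone w x).card : ℚ) - 1) ^ 2 :=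
    fun x _ => sq_two_mul_sub_one_le le_rfl (hpos' x)
  have hone : ∑ x ∈ R, (2 * ((1 : ℕ) : ℚ) - 1) ^ 2 = (Fintype.card V : ℚ) - 1 - d := by
    rw [sum_const, ← hRcard, nsmul_eq_mul]; norm_num
  have hsum₁ := sum_le_sum hle₁
  have hsum₂ := sum_le_sum hle₂
  rw [hone] at hsum₂
  refine ⟨hJ ▸ add_le_add hsum₁ hsum₂, fun heq x hx => ?_⟩
  rw [hJ, leverTime] at heq
  have heq₁ := (sum_eq_sum_iff_of_le hle₁).1 (by linarith)
  have heq₂ := (sum_eq_sum_iff_of_le hle₂).1 (by linarith)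
  have hcone₁ : ∀ i ≤ d, i ≠ k → ∀ y ∈ G.cone w (P i), ∃ j ≤ d, P j = y := by
    intro i hi hik y hy
    rw [← eq_of_subset_of_card_le (hP.image_pathBranch_subset_cone hk hgate hi hik)
      ((le_of_sq_two_mul_sub_one_eq (hpos i) (hcard i hi hik)
        (heq₁ i (mem_erase.2 ⟨hik, mem_range.2 (by omega)⟩))).trans
          (hP.card_image_pathBranch hi).ge)] at hy
    obtain ⟨j, hj, rfl⟩ := mem_image.1 hy
    refine ⟨j, ?_, rfl⟩
    unfold pathBranch at hj
    split_ifs at hj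
    · rw [mem_range] at hj; omega
    · exact (mem_Icc.1 hj).2
  have hcone₂ : ∀ x ∈ R, ∀ y ∈ G.cone w x, y = x := fun x hx y hy =>
    card_le_one.1 (le_of_sq_two_mul_sub_one_eq le_rfl (hpos' x) (heq₂ x hx)) y hy x self_mem_cone
  have hw : P k = w := by
    by_contra hne
    have hkR : P k ∈ R := (hR _).2 ⟨hne, fun i hi hik h => hik (hP.injOn hi hk h)⟩
    have h₁ := hcone₂ _ hkR (P 0) (mem_cone.2 (hgate 0 (by omega)))
    have h₂ := hcone₂ _ hkR (P d) (mem_cone.2 (hgate d le_rfl))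
    have := hP.injOn (show 0 ≤ d by omega) (show d ≤ d from le_rfl) (h₁.trans h₂.symm)
    omega
  have hxw : x ≠ w := by rintro rfl; exact hx k hk hw
  obtain ⟨p, hxp, hp⟩ := hG.connected.exists_adj_dist_add_one hxw
  have hxcone : x ∈ G.cone w p := (hG.mem_cone_iff_of_adj hxp hp).2 (Or.inr self_mem_cone)
  by_cases hpw : p = w
  · rw [hw, ← hpw]; exact hxp.symm
  by_cases hpR : p ∈ R
  · exact absurd (hcone₂ p hpR x hxcone) hxp.ne
  · rw [hR] at hpR
    push Not at hpR
    obtain ⟨i, hi, hik, rfl⟩ := hpR hpw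
    obtain ⟨j, hj, rfl⟩ := hcone₁ i hi hik x hxcone
    exact absurd rfl (hx j hj)

lemma IsTree.joinTime_le_leverTime (hG : G.IsTree) (hP : G.IsGeodesic P d) (hk : k ≤ d)
    (hleaf : ∀ x, (∀ i ≤ d, P i ≠ x) → G.Adj (P k) x) :
    joinTime G (P k) ≤ leverTime (Fintype.card V) d k := by
  have hgate : ∀ i ≤ d, G.dist (P k) (P i) = G.dist (P k) (P k) + G.dist (P k) (P i) := by simp
  obtain ⟨R, hR, hRcard, hJ⟩ := hG.joinTime_eq_geodesic_add hP hk hgate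
  have hpos : ∀ x, 1 ≤ (G.cone (P k) x).card := fun x => card_pos.2 ⟨x, self_mem_cone⟩
  have hdist : ∀ y, (∀ i ≤ d, P i ≠ y) → G.dist (P k) y = 1 :=
    fun y hy => dist_eq_one_iff_adj.2 (hleaf y hy)
  rw [hJ, leverTime, ← hRcard]
  refine add_le_add (sum_le_sum fun i hi => sq_two_mul_sub_one_le (hpos _) ?_) ?_
  · rw [mem_erase, mem_range] at hi
    have hid : i ≤ d := by omega
    rw [← hP.card_image_pathBranch hid]
    refine card_le_card fun y hy => ?_
    rw [mem_cone] at hy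
    by_cases hyP : ∃ j ≤ d, P j = y
    · obtain ⟨j, hj, rfl⟩ := hyP
      refine mem_image_of_mem _ ?_
      have h₁ := hP.dist_eq hk hid
      have h₂ := hP.dist_eq hk hj
      have h₃ := hP.dist_eq hid hj
      have : i < k ∧ j ≤ i ∨ k < i ∧ i ≤ j := by
        rcases abs_cases ((k : ℤ) - i) with h | h <;>
          rcases abs_cases ((k : ℤ) - j) with h' | h' <;>
          rcases abs_cases ((i : ℤ) - j) with h'' | h'' <;> omega
      unfold pathBranch
      split_ifs
      · rw [mem_range]; omega
      · rw [mem_Icc]; omega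
    · push Not at hyP
      have h₁ := hG.connected.pos_dist_of_ne (hyP i hid)
      have h₂ := hG.connected.pos_dist_of_ne fun h => hi.1 (hP.injOn hid hk h.symm)
      rw [hdist y hyP] at hy
      omega
  · rw [card_eq_sum_ones, Nat.cast_sum]
    refine sum_le_sum fun x hx => ?_
    rw [hR] at hx
    have hxP : ∀ i ≤ d, P i ≠ x := by
      intro i hi
      by_cases hik : i = k
      · rw [hik]; exact hx.1.symm
      · exact hx.2 i hi hik
    have hcone : (G.cone (P k) x).card ≤ 1 := by
      rw [← card_singleton x]
      refine card_le_card fun y hy => mem_singleton.2 ?_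
      rw [mem_cone, hdist x hxP] at hy
      by_cases hyP : ∃ j ≤ d, P j = y
      · obtain ⟨j, hj, rfl⟩ := hyP
        have := hG.dist_leaf hP hk hxP (hleaf x hxP) hj
        omega
      · push Not at hyP
        rw [hdist y hyP] at hy
        exact (hG.connected.dist_eq_zero_iff.1 (by omega)).symm
    have := sq_two_mul_sub_one_le (hpos x) hcone
    norm_num at this ⊢
    exact this

end LeverTime

lemma three_mul_sum_sq_odd (m : ℕ) :
    3 * ∑ i ∈ range m, (2 * ((i : ℚ) + 1) - 1) ^ 2 = 4 * (m : ℚ) ^ 3 - m := by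
  induction m with
  | zero => simp
  | succ m ih => rw [sum_range_succ, mul_add, ih]; push_cast; ring

lemma three_mul_leverTime (n k l : ℕ) :
    3 * leverTime n (k + l) k =
      (4 * (k : ℚ) ^ 3 - k) + (4 * (l : ℚ) ^ 3 - l) + 3 * ((n : ℚ) - 1 - (k + l)) := by
  have hbelow : ∑ i ∈ range k, (2 * (pathBranchSize (k + l) k i : ℚ) - 1) ^ 2 =
      ∑ i ∈ range k, (2 * ((i : ℚ) + 1) - 1) ^ 2 := by
    refine sum_congr rfl fun i hi => ?_
    rw [pathBranchSize, if_pos (mem_range.1 hi), Nat.cast_succ]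
  have habove : ∑ i ∈ range l, (2 * (pathBranchSize (k + l) k (k + (i + 1)) : ℚ) - 1) ^ 2 =
      ∑ i ∈ range l, (2 * ((i : ℚ) + 1) - 1) ^ 2 := by
    rw [← sum_range_reflect (fun i : ℕ => (2 * ((i : ℚ) + 1) - 1) ^ 2) l]
    refine sum_congr rfl fun i hi => ?_
    rw [mem_range] at hi
    rw [pathBranchSize, if_neg (by omega), Nat.cast_succ,
      show k + l - (k + (i + 1)) = l - 1 - i by omega]
  rw [leverTime, sum_erase_eq_sub (mem_range.2 (by omega)), add_assoc k l 1, sum_range_add,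
    sum_range_succ', hbelow, habove, add_zero, ← three_mul_sum_sq_odd k,
    ← three_mul_sum_sq_odd l]
  push_cast
  ring

lemma leverTime_sub_leverTime_half (n : ℕ) {d k : ℕ} (hk : k ≤ d) :
    leverTime n d k - leverTime n d (d / 2) =
      4 * d * ((((k : ℤ) - (d / 2 : ℕ)) * ((k : ℤ) - (d - d / 2 : ℕ)) : ℤ) : ℚ) := by
  have h₁ := three_mul_leverTime n k (d - k)
  have h₂ := three_mul_leverTime n (d / 2) (d - d / 2)
  rw [Nat.add_sub_cancel' hk] at h₁
  rw [Nat.add_sub_cancel' (by omega)] at h₂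
  rw [Nat.cast_sub hk] at h₁
  have h₃ : d / 2 ≤ d := by omega
  rw [Nat.cast_sub h₃] at h₂ ⊢
  generalize d / 2 = a at *
  push_cast at *
  linear_combination (h₁ - h₂) / 3

lemma leverTime_half_le (n : ℕ) {d k : ℕ} (hk : k ≤ d) :
    leverTime n d (d / 2) ≤ leverTime n d k := by
  rw [← sub_nonneg, leverTime_sub_leverTime_half n hk]
  have : 0 ≤ ((k : ℤ) - (d / 2 : ℕ)) * ((k : ℤ) - (d - d / 2 : ℕ)) := by
    rcases le_or_gt k (d / 2) with h | h
    · exact mul_nonneg_of_nonpos_of_nonpos (by omega) (by omega)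
    · exact mul_nonneg (by omega) (by omega)
  have : (0 : ℚ) ≤ ((((k : ℤ) - (d / 2 : ℕ)) * ((k : ℤ) - (d - d / 2 : ℕ)) : ℤ) : ℚ) := by
    exact_mod_cast this
  positivity

lemma eq_half_of_leverTime_eq (n : ℕ) {d k : ℕ} (hd : 1 ≤ d) (hk : k ≤ d)
    (h : leverTime n d k = leverTime n d (d / 2)) : k = d / 2 ∨ d - k = d / 2 := by
  have h₁ := leverTime_sub_leverTime_half n hk
  rw [h, sub_self, eq_comm] at h₁
  have hd : (4 * d : ℚ) ≠ 0 := by positivity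
  have := mul_eq_zero.1 (Int.cast_eq_zero.1 ((mul_eq_zero.1 h₁).resolve_left hd))
  omega

section Lever

variable {n d k : ℕ}

lemma leverGraph_adj {i j : Fin n} : (leverGraph n d k).Adj i j ↔
    i ≠ j ∧ (((i.val + 1 = j.val ∧ j.val ≤ d) ∨ (i.val = k ∧ d < j.val)) ∨
      ((j.val + 1 = i.val ∧ i.val ≤ d) ∨ (j.val = k ∧ d < i.val))) :=
  fromRel_adj _ _ _

/-- The path `v_0, …, v_d` of a lever. -/
def leverPath (hdn : d < n) (i : ℕ) : Fin n := ⟨min i d, by omega⟩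

lemma leverGraph_adj_leverPath (hdn : d < n) {i : ℕ} (hi : i < d) :
    (leverGraph n d k).Adj (leverPath hdn i) (leverPath hdn (i + 1)) := by
  rw [leverGraph_adj, ne_eq, Fin.ext_iff]
  simp only [leverPath]
  omega

lemma leverGraph_adj_of_notMem_leverPath (hk : k ≤ d) (hdn : d < n) {x : Fin n}
    (hx : ∀ i ≤ d, leverPath hdn i ≠ x) :
    (leverGraph n d k).Adj (leverPath hdn k) x := by
  have : d < x.val := by
    by_contra! h
    exact hx x.val h (Fin.ext (min_eq_left h))
  rw [leverGraph_adj, ne_eq, Fin.ext_iff]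
  simp only [leverPath]
  omega

lemma leverGraph_connected (hk : k ≤ d) (hdn : d < n) : (leverGraph n d k).Connected := by
  have hpath : ∀ i ≤ d, (leverGraph n d k).Reachable (leverPath hdn 0) (leverPath hdn i) := by
    intro i
    induction i with
    | zero => exact fun _ => Reachable.refl _
    | succ i ih =>
      exact fun hi => (ih (by omega)).trans (leverGraph_adj_leverPath hdn (by omega)).reachable
  have hall : ∀ x, (leverGraph n d k).Reachable (leverPath hdn 0) x := by
    intro x
    by_cases hx : ∃ i ≤ d, leverPath hdn i = x
    · obtain ⟨i, hi, rfl⟩ := hx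
      exact hpath i hi
    · push Not at hx
      exact (hpath k hk).trans (leverGraph_adj_of_notMem_leverPath hk hdn hx).reachable
  exact connected_iff_exists_forall_reachable _ |>.2 ⟨_, hall⟩

lemma leverGraph_isTree (hk : k ≤ d) (hdn : d < n) : (leverGraph n d k).IsTree := by
  have hconn := leverGraph_connected hk hdn
  rw [isTree_iff_connected_and_card]
  refine ⟨hconn, le_antisymm ?_ hconn.card_vert_le_card_edgeSet_add_one⟩
  -- every edge joins some vertex other than `0` to its predecessor
  let pred : Fin n → Fin n := fun i => if i.val ≤ d then leverPath hdn (i - 1) else leverPath hdn k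
  have hsub : (leverGraph n d k).edgeSet ⊆
      ((univ.erase (leverPath hdn 0)).image fun i => s(i, pred i) : Finset (Sym2 (Fin n))) := by
    intro e
    induction e with
    | h i j =>
      intro h
      rw [mem_edgeSet, leverGraph_adj] at h
      simp only [coe_image, Set.mem_image, mem_coe, mem_erase, mem_univ, and_true]
      have key : ∀ i j : Fin n, (i.val + 1 = j.val ∧ j.val ≤ d) ∨ (i.val = k ∧ d < j.val) →
          j ≠ leverPath hdn 0 ∧ pred j = i := by
        intro i j h
        simp only [pred, leverPath]
        split_ifs <;> simp only [ne_eq, Fin.ext_iff] <;> omega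
      rcases h.2 with h | h
      · obtain ⟨h₁, h₂⟩ := key i j h
        exact ⟨j, h₁, by rw [h₂, Sym2.eq_swap]⟩
      · obtain ⟨h₁, h₂⟩ := key j i h
        exact ⟨i, h₁, by rw [h₂]⟩
  have h₁ := Set.ncard_le_ncard hsub (finite_toSet _)
  rw [Set.ncard_coe_finset] at h₁
  have h₂ := h₁.trans card_image_le
  rw [card_erase_of_mem (mem_univ _), card_univ, Fintype.card_fin] at h₂
  rw [Nat.card_coe_set_eq, Nat.card_fin]
  omega

lemma leverGraph_isGeodesic (hk : k ≤ d) (hdn : d < n) :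
    (leverGraph n d k).IsGeodesic (leverPath hdn) d := by
  have hconn := leverGraph_connected hk hdn
  refine hconn.isGeodesic_of_adj (fun i hi => leverGraph_adj_leverPath hdn hi) ?_
  let pos : Fin n → ℕ := fun i => if i.val ≤ d then i.val else k
  have hstep : ∀ i j, (leverGraph n d k).Adj i j → pos j ≤ pos i + 1 := by
    intro i j h
    rw [leverGraph_adj] at h
    simp only [pos]
    split_ifs <;> omega
  have hwalk : ∀ {i j} (q : (leverGraph n d k).Walk i j), pos j ≤ pos i + q.length := by
    intro i j q
    induction q with
    | nil => simp
    | cons h q ih => rw [Walk.length_cons]; have := hstep _ _ h; omega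
  obtain ⟨q, hq⟩ := hconn.exists_walk_length_eq_dist (leverPath hdn 0) (leverPath hdn d)
  have := hwalk q
  have hd : pos (leverPath hdn d) = d := by simp [pos, leverPath]
  have h₀ : pos (leverPath hdn 0) = 0 := by simp [pos, leverPath]
  rw [hd, h₀, zero_add, hq] at this
  exact this

/-- A tree consisting of a geodesic and leaves attached to its `k`-th vertex is a lever. -/
lemma IsTree.nonempty_iso_leverGraph [Fintype V] (hG : G.IsTree) {P : ℕ → V}
    (hP : G.IsGeodesic P d) (hk : k ≤ d) (hcard : Fintype.card V = n) (hdn : d < n)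
    (hleaf : ∀ x, (∀ i ≤ d, P i ≠ x) → G.Adj (P k) x) :
    Nonempty (G ≃g leverGraph n d k) := by
  obtain ⟨g, hg⟩ := Finset.exists_equiv_extend_of_card_eq (α := Fin n) (t := (univ : Finset V))
    (by simp [hcard]) (s := univ.filter fun i : Fin n => i.val ≤ d) (f := fun i => P i)
    (subset_univ _) (by
      intro i hi j hj hij
      simp only [coe_filter, mem_univ, true_and, Set.mem_ofPred_eq] at hi hj
      exact Fin.ext (hP.injOn hi hj hij))
  let e : Fin n ≃ V := g.trans (Equiv.subtypeUnivEquiv fun x => mem_univ x)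
  have he : ∀ i : Fin n, i.val ≤ d → e i = P i := fun i hi => hg i (by simpa using hi)
  have hout : ∀ x : Fin n, d < x.val → ∀ i ≤ d, P i ≠ e x := by
    intro x hx i hi h
    rw [← he ⟨i, by omega⟩ hi] at h
    have := congrArg Fin.val (e.injective h)
    simp only at this
    omega
  have hpl : ∀ i x : Fin n, i.val ≤ d → d < x.val → (G.Adj (e i) (e x) ↔ i.val = k) := by
    intro i x hi hx
    have h₁ := hleaf _ (hout x hx)
    rw [he i hi]
    constructor
    · intro h
      have h₂ := hG.dist_leaf hP hk (hout x hx) h₁ hi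
      rw [dist_eq_one_iff_adj.2 h.symm] at h₂
      exact hP.injOn hi hk (hG.connected.dist_eq_zero_iff.1 (by omega)).symm
    · intro h; rw [h]; exact h₁
  refine ⟨(⟨e, ?_⟩ : leverGraph n d k ≃g G).symm⟩
  intro i j
  rw [leverGraph_adj, ne_eq, Fin.ext_iff]
  rcases le_or_gt i.val d with hi | hi <;> rcases le_or_gt j.val d with hj | hj
  · rw [he i hi, he j hj, hP.adj_iff hi hj]; omega
  · rw [hpl i j hi hj]; omega
  · rw [G.adj_comm, hpl j i hj hi]; omega
  · have h₁ := hleaf _ (hout i hi)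
    have h₂ := hleaf _ (hout j hj)
    refine iff_of_false (fun h => hG.dist_ne_of_adj (P k) h ?_) (by omega)
    rw [dist_eq_one_iff_adj.2 h₁, dist_eq_one_iff_adj.2 h₂]

end Lever

lemma Iso.dist_apply_le {W : Type*} {H : SimpleGraph W} (e : G ≃g H) (hG : G.Connected)
    (u v : V) :
    H.dist (e u) (e v) ≤ G.dist u v := by
  obtain ⟨q, hq⟩ := hG.exists_walk_length_eq_dist u v
  rw [← hq, ← Walk.length_map e.toHom q]
  exact dist_le _

section Jmin

variable [Fintype V]

lemma Jmin_le_joinTime (G : SimpleGraph V) (w : V) : Jmin G ≤ joinTime G w := by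
  rw [Jmin, dif_pos ⟨w⟩]
  exact inf'_le _ (mem_univ w)

lemma exists_Jmin_eq_joinTime [Nonempty V] (G : SimpleGraph V) : ∃ w, Jmin G = joinTime G w := by
  rw [Jmin, dif_pos ‹_›]
  obtain ⟨w, -, hw⟩ := exists_mem_eq_inf' univ_nonempty (joinTime G)
  exact ⟨w, hw⟩

variable {W : Type*} [Fintype W] {H : SimpleGraph W}

lemma Iso.joinTime_apply (e : G ≃g H) (hG : G.Connected) (w : V) :
    joinTime H (e w) = joinTime G w := by
  have hdist : ∀ u v, H.dist (e u) (e v) = G.dist u v := fun u v =>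
    (e.dist_apply_le hG u v).antisymm <| by
      simpa using e.symm.dist_apply_le (e.connected_iff.1 hG) (e u) (e v)
  have hdeg : ∀ u, gdeg H (e u) = gdeg G u := by
    intro u
    rw [gdeg, gdeg, ← card_map e.toEquiv.toEmbedding]
    congr 1
    ext v
    obtain ⟨v, rfl⟩ := e.surjective v
    simp only [mem_filter, mem_univ, true_and, mem_map_equiv]
    rw [show e.toEquiv.symm (e v) = v from e.symm_apply_apply v]
    exact e.map_adj_iff
  simp only [joinTime, hitTime, ell]
  rw [← Equiv.sum_comp e.toEquiv]
  refine sum_congr rfl fun u _ => ?_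
  rw [← Equiv.sum_comp e.toEquiv]
  simp [hdist, hdeg]

lemma Iso.Jmin_eq (e : G ≃g H) (hG : G.Connected) : Jmin G = Jmin H := by
  have := hG.nonempty
  have : Nonempty W := this.map e
  refine le_antisymm ?_ ?_
  · obtain ⟨w, hw⟩ := exists_Jmin_eq_joinTime H
    obtain ⟨w, rfl⟩ := e.surjective w
    rw [hw, e.joinTime_apply hG]
    exact Jmin_le_joinTime G w
  · obtain ⟨w, hw⟩ := exists_Jmin_eq_joinTime G
    rw [hw, ← e.joinTime_apply hG]
    exact Jmin_le_joinTime H _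

end Jmin

end SimpleGraph

/-- among trees of order `n` with diameter `d`, the balanced lever uniquely
minimizes `J_min`. -/
theorem Jmin_ge_balancedLever (n d : ℕ) (hd2 : 2 ≤ d) (hdn : d ≤ n - 1)
    {V : Type*} [Fintype V] (G : SimpleGraph V)
    (hT : G.IsTree) (hcard : Fintype.card V = n) (hdiam : gdiam G = d) :
    Jmin (balancedLever n d) ≤ Jmin G ∧
      (Jmin G = Jmin (balancedLever n d) ↔ Nonempty (G ≃g balancedLever n d)) := by
  have hdn' : d < n := by omega
  have hk : d / 2 ≤ d := by omega
  have hlever : Jmin (balancedLever n d) ≤ SimpleGraph.leverTime n d (d / 2) := by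
    refine (SimpleGraph.Jmin_le_joinTime _ (SimpleGraph.leverPath hdn' (d / 2))).trans ?_
    have := (SimpleGraph.leverGraph_isTree hk hdn').joinTime_le_leverTime
      (SimpleGraph.leverGraph_isGeodesic hk hdn') hk
      fun x => SimpleGraph.leverGraph_adj_of_notMem_leverPath hk hdn'
    rwa [Fintype.card_fin] at this
  have := hT.connected.nonempty
  obtain ⟨P, hP⟩ := hT.connected.exists_isGeodesic_gdiam
  rw [hdiam] at hP
  obtain ⟨w, hw⟩ := SimpleGraph.exists_Jmin_eq_joinTime G
  obtain ⟨k, hkd, hgate⟩ := hT.exists_gate hP w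
  obtain ⟨hle, heq⟩ := hT.leverTime_le_joinTime hP (by omega) hkd hgate
  rw [hcard, ← hw] at hle heq
  have hhalf := SimpleGraph.leverTime_half_le n hkd
  refine ⟨hlever.trans (hhalf.trans hle), fun h => ?_, fun ⟨e⟩ => e.Jmin_eq hT.connected⟩
  have hleaf := heq (by linarith)
  rcases SimpleGraph.eq_half_of_leverTime_eq n (by omega) hkd (by linarith) with hkd' | hkd'
  · exact hT.nonempty_iso_leverGraph hP hk hcard hdn' (hkd' ▸ hleaf)
  · refine hT.nonempty_iso_leverGraph hP.reverse hk hcard hdn' fun x hx => ?_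
    rw [show d - d / 2 = k by omega]
    refine hleaf x fun i hi => ?_
    have := hx (d - i) (by omega)
    rwa [Nat.sub_sub_self hi] at this
end
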